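/- There exists a constant N depending only on p such that for every integer n ≥ 1 and all r, s ∈ ℝ: |s·φ_n'(r)| ≤ N·|s|^p + N·φ_n(r). -/

import Mathlib

noncomputable def phi (p : ℝ) (n : ℕ) (r : ℝ) : ℝ :=
  if |r| < n then |r| ^ p
  else (n : ℝ) ^ (p - 2) * (p * (p - 1) / 2) * (|r| - n) ^ 2
        + p * (n : ℝ) ^ (p - 1) * (|r| - n) + (n : ℝ) ^ p

open Set Filter Topology

lemma abs_deriv_le_of_hasDerivWithinAt_Ici {f : ℝ → ℝ} {x D : ℝ}
    (h : HasDerivWithinAt f D (Ici x) x) : |deriv f x| ≤ |D| := by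
  by_cases hd : DifferentiableAt ℝ f x
  · rw [(uniqueDiffOn_Ici x x self_mem_Ici).eq_deriv _ hd.hasDerivAt.hasDerivWithinAt h]
  · simp [deriv_zero_of_not_differentiableAt hd]

lemma rpow_eq_rpow_sub_two_mul_sq {x p : ℝ} (hx : 0 ≤ x) (hp : 2 ≤ p) :
    x ^ p = x ^ (p - 2) * x ^ 2 := by
  rw [← Real.rpow_natCast x 2, ← Real.rpow_add_of_nonneg hx (by linarith) (by norm_num)]
  norm_num

lemma rpow_sub_one_eq_rpow_sub_two_mul {x p : ℝ} (hx : 0 ≤ x) (hp : 2 ≤ p) :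
    x ^ (p - 1) = x ^ (p - 2) * x := by
  nth_rewrite 3 [← Real.rpow_one x]
  rw [← Real.rpow_add_of_nonneg hx (by linarith) (by norm_num)]
  ring_nf

lemma phi_neg (p : ℝ) (n : ℕ) (r : ℝ) : phi p n (-r) = phi p n r := by
  simp [phi]

lemma abs_deriv_phi_le {p : ℝ} (hp : 2 ≤ p) (n : ℕ) {r : ℝ} (hr : 0 ≤ r) :
    |deriv (phi p n) r| ≤ p ^ 2 * ((min r n) ^ (p - 2) * r) := by
  have hn : (0 : ℝ) ≤ n := n.cast_nonneg
  rcases lt_or_ge r n with h | h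
  · have hd : HasDerivWithinAt (phi p n) (p * r ^ (p - 1)) (Ici r) r := by
      refine (Real.hasDerivAt_rpow_const (Or.inr (by linarith))).hasDerivWithinAt
        |>.congr_of_eventuallyEq ?_ (by simp [phi, abs_of_nonneg hr, h])
      filter_upwards [self_mem_nhdsWithin, mem_nhdsWithin_of_mem_nhds (Iio_mem_nhds h)]
        with x hx hxn
      have hx' : 0 ≤ x := hr.trans hx
      simp only [mem_Iio] at hxn
      simp [phi, abs_of_nonneg hx', hxn]
    refine (abs_deriv_le_of_hasDerivWithinAt_Ici hd).trans ?_
    rw [abs_of_nonneg (by positivity), min_eq_left h.le, rpow_sub_one_eq_rpow_sub_two_mul hr hp]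
    have : 0 ≤ r ^ (p - 2) * r := by positivity
    gcongr
    nlinarith
  · have hd : HasDerivWithinAt (phi p n)
        ((n : ℝ) ^ (p - 2) * (p * (p - 1) / 2) * (2 * (r - n)) + p * (n : ℝ) ^ (p - 1))
        (Ici r) r := by
      have key : ∀ x ∈ Ici r, phi p n x = (n : ℝ) ^ (p - 2) * (p * (p - 1) / 2) * (x - n) ^ 2
          + p * (n : ℝ) ^ (p - 1) * (x - n) + (n : ℝ) ^ p := by
        intro x hx
        have hx' : r ≤ x := hx
        rw [phi, abs_of_nonneg (hr.trans hx'), if_neg (by linarith)]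
      refine HasDerivWithinAt.congr ?_ key (key r self_mem_Ici)
      have h1 : HasDerivAt (fun x : ℝ => x - n) 1 r := (hasDerivAt_id r).sub_const _
      have h2 := (((h1.pow 2).const_mul ((n : ℝ) ^ (p - 2) * (p * (p - 1) / 2))).add
        (h1.const_mul (p * (n : ℝ) ^ (p - 1)))).add_const ((n : ℝ) ^ p)
      exact (h2.congr_deriv (by simp)).hasDerivWithinAt
    refine (abs_deriv_le_of_hasDerivWithinAt_Ici hd).trans ?_
    rw [min_eq_right h, rpow_sub_one_eq_rpow_sub_two_mul hn hp]
    have ha : 0 ≤ (n : ℝ) ^ (p - 2) := by positivity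
    have hrn : 0 ≤ r - n := by linarith
    have hp1 : 0 ≤ p - 1 := by linarith
    rw [abs_of_nonneg (by positivity)]
    have : (n : ℝ) ^ (p - 2) * (p * (p - 1) * (r - n) + p * n) ≤
        (n : ℝ) ^ (p - 2) * (p ^ 2 * r) := by
      refine mul_le_mul_of_nonneg_left ?_ ha
      have h1 : 0 ≤ p * (r - n) := by positivity
      have h2 : 0 ≤ p * (p - 1) * n := by positivity
      nlinarith
    linarith

lemma min_rpow_mul_sq_le_phi {p : ℝ} (hp : 2 ≤ p) (n : ℕ) {r : ℝ} (hr : 0 ≤ r) :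
    (min r n) ^ (p - 2) * r ^ 2 ≤ phi p n r := by
  have hn : (0 : ℝ) ≤ n := n.cast_nonneg
  rw [phi, abs_of_nonneg hr]
  split_ifs with h
  · rw [min_eq_left h.le, rpow_eq_rpow_sub_two_mul_sq hr hp]
  · rw [not_lt] at h
    rw [min_eq_right h, rpow_sub_one_eq_rpow_sub_two_mul hn hp, rpow_eq_rpow_sub_two_mul_sq hn hp]
    have ha : 0 ≤ (n : ℝ) ^ (p - 2) := by positivity
    have : (n : ℝ) ^ (p - 2) * r ^ 2 ≤ (n : ℝ) ^ (p - 2) *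
        (p * (p - 1) / 2 * (r - n) ^ 2 + p * n * (r - n) + (n : ℝ) ^ 2) := by
      refine mul_le_mul_of_nonneg_left ?_ ha
      have hc : 0 ≤ p * (p - 1) / 2 - 1 := by nlinarith
      have h1 : 0 ≤ (p * (p - 1) / 2 - 1) * (r - n) ^ 2 := mul_nonneg hc (sq_nonneg _)
      have h2 : 0 ≤ (p - 2) * (n * (r - n)) :=
        mul_nonneg (by linarith) (mul_nonneg hn (by linarith))
      linarith
    linarith

lemma mul_rpow_mul_le_add {p m r s : ℝ} (hp : 2 ≤ p) (hm : 0 ≤ m) (hmr : m ≤ r) (hs : 0 ≤ s) :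
    s * (m ^ (p - 2) * r) ≤ s ^ p + m ^ (p - 2) * r ^ 2 := by
  have hr : 0 ≤ r := hm.trans hmr
  rcases le_total s r with h | h
  · calc s * (m ^ (p - 2) * r) ≤ r * (m ^ (p - 2) * r) := by gcongr
      _ = m ^ (p - 2) * r ^ 2 := by ring
      _ ≤ _ := le_add_of_nonneg_left (by positivity)
  · have hp2 : 0 ≤ p - 2 := by linarith
    calc s * (m ^ (p - 2) * r) ≤ s * (s ^ (p - 2) * s) := by
          gcongr
          exact hmr.trans h
      _ = s ^ p := by rw [rpow_eq_rpow_sub_two_mul_sq hs hp]; ring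
      _ ≤ _ := le_add_of_nonneg_right (by positivity)

theorem phi_free_term_bound (p : ℝ) (hp : 2 ≤ p) :
    ∃ N : ℝ, ∀ n : ℕ, 1 ≤ n → ∀ r s : ℝ,
      |s * deriv (phi p n) r| ≤ N * |s| ^ p + N * phi p n r := by
  refine ⟨p ^ 2, fun n _ => ?_⟩
  have nonneg_case : ∀ r s : ℝ, 0 ≤ r →
      |s * deriv (phi p n) r| ≤ p ^ 2 * |s| ^ p + p ^ 2 * phi p n r := by
    intro r s hr
    calc |s * deriv (phi p n) r| = |s| * |deriv (phi p n) r| := abs_mul _ _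
      _ ≤ |s| * (p ^ 2 * ((min r n) ^ (p - 2) * r)) := by
          gcongr
          exact abs_deriv_phi_le hp n hr
      _ = p ^ 2 * (|s| * ((min r n) ^ (p - 2) * r)) := by ring
      _ ≤ p ^ 2 * (|s| ^ p + (min r n) ^ (p - 2) * r ^ 2) := by
          gcongr
          exact mul_rpow_mul_le_add hp (le_min hr n.cast_nonneg) (min_le_left _ _) (abs_nonneg s)
      _ ≤ p ^ 2 * (|s| ^ p + phi p n r) := by
          gcongr
          exact min_rpow_mul_sq_le_phi hp n hr
      _ = _ := by ring
  intro r s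
  rcases le_total 0 r with hr | hr
  · exact nonneg_case r s hr
  · have hd := deriv_comp_neg (phi p n) r
    simp only [phi_neg] at hd
    have h := nonneg_case (-r) s (by linarith)
    rw [phi_neg] at h
    rwa [show deriv (phi p n) r = -deriv (phi p n) (-r) from hd, mul_neg, abs_neg]
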